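/- Let φ(t) = max(1 − t, 0) be the hinge loss, K^E the Epanechnikov kernel, and h > 0. Then the convolution-smoothed hinge loss φ_h(t) = ∫_ℝ φ(t + h v) K^E(v) dv is twice differentiable at every t ∈ ℝ, with second derivative φ_h″(t) = K^E((1 − t)/h)/h; explicitly, φ_h″(t) = (3/(4h))·(1 − s²) with s = (1 − t)/h when |1 − t| ≤ h, and φ_h″(t) = 0 otherwise. -/

import Mathlib

open MeasureTheory

/-- The hinge loss `φ(t) = max(1 − t, 0)`. -/
noncomputable def hinge (t : ℝ) : ℝ := max (1 - t) 0

/-- The Epanechnikov kernel `K^E(u) = (3/4)(1 − u²)` for `|u| ≤ 1`, and `0` otherwise. -/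
noncomputable def epan (u : ℝ) : ℝ := if |u| ≤ 1 then (3 / 4) * (1 - u ^ 2) else 0

/-- The convolution-smoothed hinge loss `φ_h(t) = ∫ φ(t + h v) K(v) dv`. -/
noncomputable def smoothedHinge (K : ℝ → ℝ) (h t : ℝ) : ℝ :=
  ∫ v : ℝ, hinge (t + h * v) * K v

theorem epan_eq_max (u : ℝ) : epan u = 3 / 4 * max (1 - u ^ 2) 0 := by
  unfold epan
  split_ifs with hu
  · rw [max_eq_left (by linarith [(sq_le_one_iff_abs_le_one u).2 hu])]
  · rw [max_eq_right, mul_zero]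
    have := mt (sq_le_one_iff_abs_le_one u).1 hu
    linarith

theorem continuous_epan : Continuous epan := by
  rw [funext epan_eq_max]
  fun_prop

theorem epan_eq_zero_of_le {u : ℝ} (hu : u ≤ -1) : epan u = 0 := by
  rw [epan_eq_max, max_eq_right (by nlinarith), mul_zero]

/-- For a kernel vanishing on `(-∞, a]`, the smoothed hinge loss is an integral over a bounded
interval. -/
theorem smoothedHinge_eq_intervalIntegral {K : ℝ → ℝ} {a h : ℝ} (hh : 0 < h)
    (hK : ∀ v ≤ a, K v = 0) (t : ℝ) :
    smoothedHinge K h t = h * ∫ v in a..(1 - t) / h, ((1 - t) / h - v) * K v := by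
  have hzero : ∫ v in Set.Ioc ((1 - t) / h) a, ((1 - t) / h - v) * K v = 0 :=
    setIntegral_eq_zero_of_forall_eq_zero fun v hv => by rw [hK v hv.2, mul_zero]
  rw [intervalIntegral, hzero, sub_zero, ← integral_indicator measurableSet_Ioc,
    ← integral_const_mul, smoothedHinge]
  congr 1
  funext v
  have hs : 1 - (t + h * v) = h * ((1 - t) / h - v) := by
    field_simp
    ring
  rw [hinge, hs]
  by_cases hv : v ∈ Set.Ioc a ((1 - t) / h)
  · rw [Set.indicator_of_mem hv, max_eq_left (mul_nonneg hh.le (sub_nonneg.2 hv.2)), mul_assoc]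
  · rw [Set.indicator_of_notMem hv, mul_zero]
    rcases le_or_gt v a with hva | hva
    · rw [hK v hva, mul_zero]
    · have hlt : (1 - t) / h < v := not_le.1 fun hle => hv ⟨hva, hle⟩
      rw [max_eq_right (mul_nonpos_of_nonneg_of_nonpos hh.le (sub_nonpos.2 hlt.le)), zero_mul]

theorem hasDerivAt_intervalIntegral_sub_mul {K : ℝ → ℝ} (hK : Continuous K) (a s : ℝ) :
    HasDerivAt (fun s => ∫ v in a..s, (s - v) * K v) (∫ v in a..s, K v) s := by
  have hvK : Continuous fun v => v * K v := continuous_id.mul hK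
  have hsplit : (fun s => ∫ v in a..s, (s - v) * K v) =
      fun s => s * (∫ v in a..s, K v) - ∫ v in a..s, v * K v := by
    funext s
    have hsK : Continuous fun v => s * K v := continuous_const.mul hK
    rw [← intervalIntegral.integral_const_mul, ← intervalIntegral.integral_sub
      (hsK.intervalIntegrable _ _) (hvK.intervalIntegrable _ _)]
    simp only [sub_mul]
  rw [hsplit]
  refine (((hasDerivAt_id s).mul (hK.integral_hasStrictDerivAt a s).hasDerivAt).sub
    (hvK.integral_hasStrictDerivAt a s).hasDerivAt).congr_deriv ?_
  simp

theorem hasDerivAt_one_sub_div (h t : ℝ) :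
    HasDerivAt (fun t : ℝ => (1 - t) / h) (-1 / h) t :=
  ((hasDerivAt_id t).const_sub 1).div_const h

/-- The first derivative of the smoothed hinge loss is minus the distribution function of the
kernel. -/
theorem hasDerivAt_smoothedHinge {K : ℝ → ℝ} {a h : ℝ} (hh : 0 < h) (hKc : Continuous K)
    (hK : ∀ v ≤ a, K v = 0) (t : ℝ) :
    HasDerivAt (smoothedHinge K h) (-∫ v in a..(1 - t) / h, K v) t := by
  rw [funext (smoothedHinge_eq_intervalIntegral hh hK)]
  refine (((hasDerivAt_intervalIntegral_sub_mul hKc a ((1 - t) / h)).comp t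
    (hasDerivAt_one_sub_div h t)).const_mul h).congr_deriv ?_
  field_simp

theorem hasDerivAt_deriv_smoothedHinge {K : ℝ → ℝ} {a h : ℝ} (hh : 0 < h) (hKc : Continuous K)
    (hK : ∀ v ≤ a, K v = 0) (t : ℝ) :
    HasDerivAt (deriv (smoothedHinge K h)) (K ((1 - t) / h) / h) t := by
  rw [funext fun t => (hasDerivAt_smoothedHinge hh hKc hK t).deriv]
  refine ((hKc.integral_hasStrictDerivAt a ((1 - t) / h)).hasDerivAt.comp t
    (hasDerivAt_one_sub_div h t)).neg.congr_deriv ?_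
  ring

/-- The Epanechnikov-smoothed hinge loss is twice differentiable at every point, with second
derivative `φ_h″(t) = K^E((1 − t)/h)/h`, having the stated explicit piecewise form. -/
theorem smoothedHinge_epan_second_deriv (h : ℝ) (hh : 0 < h) :
    (∀ t : ℝ, DifferentiableAt ℝ (smoothedHinge epan h) t) ∧
    (∀ t : ℝ, HasDerivAt (deriv (smoothedHinge epan h)) (epan ((1 - t) / h) / h) t) ∧
    (∀ t : ℝ, |1 - t| ≤ h →
      deriv (deriv (smoothedHinge epan h)) t = 3 / (4 * h) * (1 - ((1 - t) / h) ^ 2)) ∧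
    (∀ t : ℝ, h < |1 - t| → deriv (deriv (smoothedHinge epan h)) t = 0) := by
  have hsecond (t : ℝ) : HasDerivAt (deriv (smoothedHinge epan h)) (epan ((1 - t) / h) / h) t :=
    hasDerivAt_deriv_smoothedHinge hh continuous_epan (fun _ => epan_eq_zero_of_le) t
  have habs (t : ℝ) : |(1 - t) / h| = |1 - t| / h := by rw [abs_div, abs_of_pos hh]
  refine ⟨fun t => (hasDerivAt_smoothedHinge hh continuous_epan
    (fun _ => epan_eq_zero_of_le) t).differentiableAt, hsecond, fun t ht => ?_, fun t ht => ?_⟩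
  · rw [(hsecond t).deriv, epan, if_pos (by rwa [habs, div_le_one hh])]
    field_simp
  · rw [(hsecond t).deriv, epan, if_neg (by rwa [habs, div_le_one hh, not_le]), zero_div]
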